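/- arXiv:2102.03977 — 2 statements merged into one kernel-verified Lean document; each statement's English description precedes it below -/
import Mathlib

section
/- Let V be a finite set of n ≥ 3 nodes, let C ⊆ V be nonempty, let A ⊆ C be nonempty, and set α = |A|/|C|. Draw a random subset S ⊆ V by Bernoulli sampling with rate p ∈ [0,1]. Fix ε with 0 < ε ≤ 1, and suppose p·|A| ≥ (12/ε²)·ln n. Then with probability at least 1 − 4/n, one has C ∩ S ≠ ∅ and α·(1 − ε) ≤ |A ∩ S| / |C ∩ S| ≤ α·(1 + 2ε). -/
/-- The probability that the Bernoulli-`p` random subset of the finite type `V`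
(each node included independently with probability `p`) equals `S`. -/
noncomputable def bernoulliWeight {V : Type*} [Fintype V] [DecidableEq V]
    (p : ℝ) (S : Finset V) : ℝ :=
  p ^ S.card * (1 - p) ^ (Fintype.card V - S.card)

open Classical in
/-- Probability of the event `A` under Bernoulli-`p` sampling of a subset of `V`. -/
noncomputable def prEvent {V : Type*} [Fintype V] [DecidableEq V]
    (p : ℝ) (A : Finset V → Prop) : ℝ :=
  ∑ S : Finset V, if A S then bernoulliWeight p S else 0

theorem exp_quad (x : ℝ) (hx : |x| ≤ 1 / 2) : Real.exp x ≤ 1 + x + 2 / 3 * x ^ 2 := by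
  have h := Real.exp_bound (x := x) (by linarith) (n := 3) (by norm_num)
  have h1 := (abs_le.mp h).2
  simp [Finset.sum_range_succ, Nat.factorial] at h1
  have h2 : |x| ^ 3 ≤ 1 / 2 * x ^ 2 := by
    rw [pow_succ, sq_abs]
    nlinarith [sq_nonneg x]
  norm_num at h1
  nlinarith [sq_nonneg x]

theorem weight_nonneg {V : Type*} [Fintype V] [DecidableEq V]
    (p : ℝ) (hp0 : 0 ≤ p) (hp1 : p ≤ 1) (S : Finset V) : 0 ≤ bernoulliWeight p S := by
  unfold bernoulliWeight
  have : 0 ≤ 1 - p := by linarith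
  positivity

theorem mgf_eq {V : Type*} [Fintype V] [DecidableEq V] (p t : ℝ) (B : Finset V) :
    ∑ S : Finset V, bernoulliWeight p S * Real.exp (t * ((B ∩ S).card : ℝ))
      = (1 + p * (Real.exp t - 1)) ^ B.card := by
  have h := Finset.prod_add (fun v : V => p * (if v ∈ B then Real.exp t else 1))
    (fun _ => 1 - p) Finset.univ
  have hl : ∏ v : V, (p * (if v ∈ B then Real.exp t else 1) + (1 - p))
      = (1 + p * (Real.exp t - 1)) ^ B.card := by
    have : ∀ v : V, (p * (if v ∈ B then Real.exp t else 1) + (1 - p))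
        = if v ∈ B then (1 + p * (Real.exp t - 1)) else 1 := by
      intro v
      split_ifs <;> ring
    simp only [this]
    rw [Finset.prod_ite]
    simp
  rw [← hl, h, Finset.powerset_univ]
  refine Finset.sum_congr rfl fun S _ => ?_
  rw [Finset.prod_mul_distrib, Finset.prod_ite]
  simp only [Finset.prod_const, Finset.prod_const_one, mul_one]
  rw [Finset.card_sdiff_of_subset (Finset.subset_univ S), Finset.card_univ,
    Finset.filter_mem_eq_inter, Finset.inter_comm S B, mul_comm t, Real.exp_nat_mul]
  unfold bernoulliWeight
  ring

theorem weight_sum {V : Type*} [Fintype V] [DecidableEq V] (p : ℝ) :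
    ∑ S : Finset V, bernoulliWeight p S = 1 := by
  have h := mgf_eq p 0 (∅ : Finset V)
  simpa using h

theorem tail {V : Type*} [Fintype V] [DecidableEq V] (p : ℝ) (hp0 : 0 ≤ p) (hp1 : p ≤ 1)
    (x : ℝ) (hx : |x| ≤ 1 / 2) (B : Finset V) (n : ℕ) (hn : 0 < n)
    (h : Real.log n ≤ p * B.card * x ^ 2 / 3) :
    ∑ S : Finset V, bernoulliWeight p S *
      Real.exp (x * ((B ∩ S).card : ℝ) - (x + x ^ 2) * (p * B.card)) ≤ 1 / n := by
  have e : ∀ S : Finset V, bernoulliWeight p S *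
      Real.exp (x * ((B ∩ S).card : ℝ) - (x + x ^ 2) * (p * B.card))
      = (bernoulliWeight p S * Real.exp (x * ((B ∩ S).card : ℝ))) *
        Real.exp (-((x + x ^ 2) * (p * B.card))) := by
    intro S
    rw [sub_eq_add_neg, Real.exp_add, mul_assoc]
  simp only [e]
  rw [← Finset.sum_mul, mgf_eq]
  have hb : (1 + p * (Real.exp x - 1)) ^ B.card
      ≤ Real.exp (B.card * (p * (x + 2 / 3 * x ^ 2))) := by
    rw [Real.exp_nat_mul]
    apply pow_le_pow_left₀
    · have := Real.exp_pos x
      nlinarith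
    · have h1 := exp_quad x hx
      have h2 := Real.add_one_le_exp (p * (x + 2 / 3 * x ^ 2))
      nlinarith
  have hn' : (0 : ℝ) < n := by exact_mod_cast hn
  calc _ ≤ Real.exp (B.card * (p * (x + 2 / 3 * x ^ 2))) *
        Real.exp (-((x + x ^ 2) * (p * B.card))) := by gcongr
    _ = Real.exp (-(p * B.card * x ^ 2 / 3)) := by
        rw [← Real.exp_add]; congr 1; ring
    _ ≤ Real.exp (-Real.log n) := by
        apply Real.exp_le_exp.mpr; linarith
    _ = 1 / n := by rw [Real.exp_neg, Real.exp_log hn', one_div]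

theorem good_det (a c X Y p δ : ℝ) (hc : 0 < c) (ha : 0 < a) (hp : 0 < p)
    (hδ0 : 0 < δ) (hδ1 : δ ≤ 1 / 2)
    (h1 : X ≤ (1 + δ) * (p * a)) (h2 : (1 - δ) * (p * a) ≤ X)
    (h3 : Y ≤ (1 + δ) * (p * c)) (h4 : (1 - δ) * (p * c) ≤ Y) :
    0 < Y ∧ a / c * (1 - 2 * δ) ≤ X / Y ∧ X / Y ≤ a / c * (1 + 2 * (2 * δ)) := by
  have hpc : 0 < p * c := by positivity
  have hpa : 0 < p * a := by positivity
  have hY : 0 < Y := by nlinarith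
  refine ⟨hY, ?_, ?_⟩
  · rw [le_div_iff₀ hY]
    have k : 0 ≤ a / c * (1 - 2 * δ) := mul_nonneg (by positivity) (by linarith)
    calc _ ≤ a / c * (1 - 2 * δ) * ((1 + δ) * (p * c)) := by gcongr
      _ = (1 - 2 * δ) * (1 + δ) * (p * a) := by field_simp
      _ ≤ (1 - δ) * (p * a) := by gcongr; nlinarith
      _ ≤ X := h2
  · rw [div_le_iff₀ hY]
    calc X ≤ (1 + δ) * (p * a) := h1
      _ ≤ (1 + 2 * (2 * δ)) * (1 - δ) * (p * a) := by gcongr; nlinarith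
      _ = a / c * (1 + 2 * (2 * δ)) * ((1 - δ) * (p * c)) := by field_simp
      _ ≤ _ := by gcongr

/-- core threshold estimation: if `p·|A| ≥ (12/ε²)·ln n`, then with
probability at least `1 − 4/n` the sampled fraction `|A ∩ S|/|C ∩ S|` lies in
`[α(1−ε), α(1+2ε)]`, where `α = |A|/|C|`. -/
theorem stmt_3 {V : Type*} [Fintype V] [DecidableEq V]
    (n : ℕ) (hn : Fintype.card V = n) (hn3 : 3 ≤ n)
    (C A : Finset V) (hC : C.Nonempty) (hA : A.Nonempty) (hAC : A ⊆ C)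
    (α : ℝ) (hα : α = (A.card : ℝ) / (C.card : ℝ))
    (p : ℝ) (hp0 : 0 ≤ p) (hp1 : p ≤ 1)
    (ε : ℝ) (hε0 : 0 < ε) (hε1 : ε ≤ 1)
    (hpA : (12 / ε ^ 2) * Real.log n ≤ p * (A.card : ℝ)) :
    1 - 4 / (n : ℝ) ≤
      prEvent p (fun S => (C ∩ S).Nonempty ∧
        α * (1 - ε) ≤ ((A ∩ S).card : ℝ) / (((C ∩ S).card : ℝ)) ∧
        ((A ∩ S).card : ℝ) / (((C ∩ S).card : ℝ)) ≤ α * (1 + 2 * ε)) := by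
  obtain ⟨δ, rfl⟩ : ∃ δ, ε = 2 * δ := ⟨ε / 2, by ring⟩
  have hδ0 : 0 < δ := by linarith
  have hδ1 : δ ≤ 1 / 2 := by linarith
  have ha : (0 : ℝ) < A.card := by exact_mod_cast hA.card_pos
  have hc : (0 : ℝ) < C.card := by exact_mod_cast hC.card_pos
  have hac : (A.card : ℝ) ≤ C.card := by exact_mod_cast Finset.card_le_card hAC
  have hlog : 0 < Real.log n := Real.log_pos (by exact_mod_cast (by omega : 1 < n))
  have hpos : 0 < p * (A.card : ℝ) := lt_of_lt_of_le (by positivity) hpA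
  have hp : 0 < p := by
    rcases hp0.lt_or_eq with h | h
    · exact h
    · rw [← h] at hpos; simp at hpos
  have hLA : Real.log n ≤ p * A.card * δ ^ 2 / 3 := by
    have e : 12 / (2 * δ) ^ 2 * Real.log n = 3 * Real.log n / δ ^ 2 := by
      field_simp; ring
    rw [e, div_le_iff₀ (by positivity)] at hpA
    linarith
  have hLC : Real.log n ≤ p * C.card * δ ^ 2 / 3 := hLA.trans (by gcongr)
  have hab : |δ| ≤ 1 / 2 := by rwa [abs_of_pos hδ0]
  have hab' : |-δ| ≤ 1 / 2 := by rwa [abs_neg]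
  have hn0 : 0 < n := by omega
  have t1 := tail p hp0 hp1 δ hab A n hn0 hLA
  have t2 := tail p hp0 hp1 (-δ) hab' A n hn0 (by rwa [neg_sq])
  have t3 := tail p hp0 hp1 δ hab C n hn0 hLC
  have t4 := tail p hp0 hp1 (-δ) hab' C n hn0 (by rwa [neg_sq])
  have hw := weight_sum (V := V) p
  set f : ℝ → Finset V → Finset V → ℝ := fun x B S => bernoulliWeight p S *
      Real.exp (x * ((B ∩ S).card : ℝ) - (x + x ^ 2) * (p * B.card)) with hf
  have key : ∑ S : Finset V, (bernoulliWeight p S -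
      (f δ A S + f (-δ) A S + f δ C S + f (-δ) C S)) ≤ prEvent p (fun S => (C ∩ S).Nonempty ∧
        α * (1 - 2 * δ) ≤ ((A ∩ S).card : ℝ) / (((C ∩ S).card : ℝ)) ∧
        ((A ∩ S).card : ℝ) / (((C ∩ S).card : ℝ)) ≤ α * (1 + 2 * (2 * δ))) := by
    unfold prEvent
    refine Finset.sum_le_sum fun S _ => ?_
    have w0 := weight_nonneg p hp0 hp1 S
    have f0 : ∀ x B, 0 ≤ f x B S := fun x B => mul_nonneg w0 (Real.exp_pos _).le
    have f1 : ∀ x B, 0 ≤ x * ((B ∩ S).card : ℝ) - (x + x ^ 2) * (p * B.card) →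
        bernoulliWeight p S ≤ f x B S := fun x B h =>
      le_mul_of_one_le_right w0 (Real.one_le_exp h)
    have g1 := f0 δ A
    have g2 := f0 (-δ) A
    have g3 := f0 δ C
    have g4 := f0 (-δ) C
    split_ifs with hg
    · linarith
    · by_contra hcon
      push Not at hcon
      have up : ∀ B, f δ B S < bernoulliWeight p S →
          ((B ∩ S).card : ℝ) ≤ (1 + δ) * (p * B.card) := by
        intro B hB
        by_contra hh
        push Not at hh
        have := f1 δ B (by nlinarith)
        linarith
      have lo : ∀ B, f (-δ) B S < bernoulliWeight p S →
          (1 - δ) * (p * B.card) ≤ ((B ∩ S).card : ℝ) := by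
        intro B hB
        by_contra hh
        push Not at hh
        have := f1 (-δ) B (by nlinarith)
        linarith
      obtain ⟨q1, q2, q3⟩ := good_det A.card C.card (A ∩ S).card (C ∩ S).card p δ hc ha hp
        hδ0 hδ1 (up A (by linarith)) (lo A (by linarith)) (up C (by linarith))
        (lo C (by linarith))
      apply hg
      rw [hα]
      exact ⟨Finset.card_pos.mp (by exact_mod_cast q1), q2, q3⟩
  refine le_trans ?_ key
  rw [Finset.sum_sub_distrib, Finset.sum_add_distrib, Finset.sum_add_distrib,
    Finset.sum_add_distrib, hw]
  have e : (4 : ℝ) / n = 1 / n + 1 / n + 1 / n + 1 / n := by ring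
  rw [e]
  linarith
end

section
/- Let V be a finite set of n ≥ 3 nodes equipped with a metric d, partitioned into ground-truth clusters C₁*, …, C_k*, and let C₁* satisfy |C₁*| ≥ n/k with a nonempty subset A ⊆ C₁* of size |A| = β·|C₁*|. Fix ε with 0 < ε ≤ 1 and draw a random subset S ⊆ V by Bernoulli sampling with rate p = m/n, where m is an integer with max(10·k, 12·k/(β·ε²))·ln n ≤ m ≤ n. Suppose moreover that the partition {C₁*, …, C_k*} satisfies the margin property on every subset of V. Then with probability at least 1 − k·n^{−5/4} − 4/n the following all hold: (i) |S ∩ C_i*| ≥ 5·ln n for every i with |C_i*| ≥ n/k; (ii) every partition of S reachable from the singleton partition of S by complete-linkage closest-pair merge steps and having exactly k' blocks, where k' is the number of indices i with C_i* ∩ S ≠ ∅, equals {C_i* ∩ S : C_i* ∩ S ≠ ∅}; and (iii) β·(1 − ε) ≤ |A ∩ S| / |C₁* ∩ S| ≤ β·(1 + 2ε), i.e., the constraint threshold estimated from the recovered cluster C₁* ∩ S is within a multiplicative factor (1 − ε, 1 + 2ε) of the true threshold β. -/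
/-- The indexed partition `Cstar` satisfies the margin property on `W`: any two
distinct points of `W` in the same block are strictly closer than any two points
of `W` lying in two distinct blocks. -/
def MarginOnIdx {V : Type*} [MetricSpace V] {k : ℕ}
    (Cstar : Fin k → Finset V) (W : Finset V) : Prop :=
  ∀ u ∈ W, ∀ v ∈ W, ∀ x ∈ W, ∀ y ∈ W,
    u ≠ v → (∃ i, u ∈ Cstar i ∧ v ∈ Cstar i) →
    (∃ i j, i ≠ j ∧ x ∈ Cstar i ∧ y ∈ Cstar j) →
    dist u v < dist x y

/-- Complete-linkage distance between two finite sets of points: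
`d(D₁,D₂) = max_{u ∈ D₁, v ∈ D₂} d(u,v)`. -/
noncomputable def clDist {V : Type*} [MetricSpace V] (D₁ D₂ : Finset V) : ℝ :=
  sSup {r : ℝ | ∃ u ∈ D₁, ∃ v ∈ D₂, r = dist u v}

/-- A single closest-pair merge step: replace two distinct blocks `D₁, D₂`
minimizing the complete-linkage distance by their union. -/
def MergeStep {V : Type*} [MetricSpace V] [DecidableEq V]
    (D D' : Finset (Finset V)) : Prop :=
  ∃ D₁ ∈ D, ∃ D₂ ∈ D, D₁ ≠ D₂ ∧
    (∀ E₁ ∈ D, ∀ E₂ ∈ D, E₁ ≠ E₂ → clDist D₁ D₂ ≤ clDist E₁ E₂) ∧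
    D' = insert (D₁ ∪ D₂) ((D.erase D₁).erase D₂)

section Prob

variable {V : Type*} [Fintype V] [DecidableEq V]

theorem bw_nonneg {p : ℝ} (h0 : 0 ≤ p) (h1 : p ≤ 1) (S : Finset V) :
    0 ≤ bernoulliWeight p S :=
  mul_nonneg (pow_nonneg h0 _) (pow_nonneg (by linarith) _)

theorem bw_mgf (p x : ℝ) (B : Finset V) :
    ∑ S : Finset V, bernoulliWeight p S * x ^ (B ∩ S).card = (1 - p + p * x) ^ B.card := by
  have h := Finset.prod_add (fun i : V => p * (if i ∈ B then x else 1)) (fun _ => 1 - p) Finset.univ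
  have hL : ∏ i : V, (p * (if i ∈ B then x else 1) + (1 - p)) = (1 - p + p * x) ^ B.card := by
    have : ∀ i : V, (p * (if i ∈ B then x else 1) + (1 - p)) =
        if i ∈ B then (1 - p + p * x) else 1 := by
      intro i; split_ifs <;> ring
    simp only [this]
    rw [Finset.prod_ite_mem, Finset.univ_inter, Finset.prod_const]
  rw [← hL, h, Finset.powerset_univ]
  refine Finset.sum_congr rfl fun S _ => ?_
  rw [Finset.prod_mul_distrib, Finset.prod_const, Finset.prod_const, Finset.prod_ite_mem,
    Finset.prod_const, Finset.card_sdiff_of_subset (Finset.subset_univ _), Finset.card_univ,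
    Finset.inter_comm S B, bernoulliWeight]
  ring

theorem bw_sum (p : ℝ) : ∑ S : Finset V, bernoulliWeight p S = 1 := by
  have := bw_mgf (V := V) p 1 ∅
  simpa using this

theorem pr_mono {p : ℝ} (h0 : 0 ≤ p) (h1 : p ≤ 1) {P Q : Finset V → Prop}
    (h : ∀ S, P S → Q S) : prEvent p P ≤ prEvent p Q := by
  unfold prEvent
  refine Finset.sum_le_sum fun S _ => ?_
  have := bw_nonneg h0 h1 S
  have := h S
  split_ifs <;> first | tauto | linarith

theorem pr_or {p : ℝ} (h0 : 0 ≤ p) (h1 : p ≤ 1) (P Q : Finset V → Prop) :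
    prEvent p (fun S => P S ∨ Q S) ≤ prEvent p P + prEvent p Q := by
  unfold prEvent
  rw [← Finset.sum_add_distrib]
  refine Finset.sum_le_sum fun S _ => ?_
  have := bw_nonneg h0 h1 S
  split_ifs <;> first | tauto | linarith

theorem pr_not (p : ℝ) (P : Finset V → Prop) :
    1 - prEvent p (fun S => ¬ P S) = prEvent p P := by
  rw [← bw_sum (V := V) p]
  unfold prEvent
  rw [← Finset.sum_sub_distrib]
  refine Finset.sum_congr rfl fun S _ => ?_
  by_cases h : P S <;> simp [h]

theorem pr_ex {p : ℝ} (h0 : 0 ≤ p) (h1 : p ≤ 1) {ι : Type*} [Fintype ι]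
    (P : ι → Finset V → Prop) :
    prEvent p (fun S => ∃ i, P i S) ≤ ∑ i, prEvent p (P i) := by
  classical
  unfold prEvent
  rw [Finset.sum_comm]
  refine Finset.sum_le_sum fun S _ => ?_
  have hw := bw_nonneg h0 h1 S
  have hnn : ∀ i ∈ (Finset.univ : Finset ι), 0 ≤ if P i S then bernoulliWeight p S else 0 := by
    intro i _; split_ifs <;> simp [hw]
  split_ifs with h
  · obtain ⟨i, hi⟩ := h
    have := Finset.single_le_sum hnn (Finset.mem_univ i)
    simpa [hi] using this
  · exact Finset.sum_nonneg hnn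

theorem pr_markov {p : ℝ} (h0 : 0 ≤ p) (h1 : p ≤ 1) (B : Finset V) (t r : ℝ)
    (P : Finset V → Prop) (hP : ∀ S, P S → r ≤ t * ((B ∩ S).card : ℝ)) :
    prEvent p P ≤ Real.exp (p * B.card * (Real.exp t - 1) - r) := by
  have e1 : prEvent p P ≤ ∑ S : Finset V,
      (bernoulliWeight p S * (Real.exp t) ^ (B ∩ S).card) * Real.exp (-r) := by
    unfold prEvent
    refine Finset.sum_le_sum fun S _ => ?_
    have hw := bw_nonneg h0 h1 S
    split_ifs with h
    · have h2 := hP S h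
      rw [mul_assoc]
      refine le_mul_of_one_le_right hw ?_
      rw [← Real.exp_nat_mul, ← Real.exp_add]
      apply Real.one_le_exp
      linarith
    · positivity
  rw [← Finset.sum_mul, bw_mgf] at e1
  refine e1.trans ?_
  rw [sub_eq_add_neg (p * B.card * (Real.exp t - 1)) r, Real.exp_add]
  refine mul_le_mul_of_nonneg_right ?_ (Real.exp_pos _).le
  have h3 : 1 - p + p * Real.exp t ≤ Real.exp (p * (Real.exp t - 1)) := by
    have := Real.add_one_le_exp (p * (Real.exp t - 1)); linarith
  have h4 : 0 ≤ 1 - p + p * Real.exp t := by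
    have := mul_nonneg h0 (Real.exp_pos t).le; linarith
  calc _ ≤ (Real.exp (p * (Real.exp t - 1))) ^ B.card := pow_le_pow_left₀ h4 h3 _
    _ = _ := by rw [← Real.exp_nat_mul]; congr 1; ring

theorem pr_low {p : ℝ} (h0 : 0 ≤ p) (h1 : p ≤ 1) (B : Finset V) (δ : ℝ) (hδ : 0 ≤ δ) :
    prEvent p (fun S => ((B ∩ S).card : ℝ) ≤ (1 - δ) * (p * B.card)) ≤
      Real.exp (-(p * B.card * δ ^ 2 / 2)) := by
  refine (pr_markov h0 h1 B (-δ) (-δ * ((1 - δ) * (p * B.card))) _ ?_).trans ?_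
  · intro S hS
    have := mul_le_mul_of_nonneg_left hS hδ
    linarith
  · apply Real.exp_le_exp.2
    have h2 : Real.exp (-δ) ≤ 1 - δ + δ ^ 2 / 2 := by
      have h3 := Real.quadratic_le_exp_of_nonneg hδ
      have h4 : Real.exp (-δ) * Real.exp δ = 1 := by rw [← Real.exp_add]; simp
      have h5 : 0 < 1 - δ + δ ^ 2 / 2 := by nlinarith [sq_nonneg (δ - 1)]
      have h6 := mul_le_mul_of_nonneg_left h3 h5.le
      have h7 : 1 ≤ (1 - δ + δ ^ 2 / 2) * Real.exp δ := by
        have := pow_nonneg hδ 4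
        nlinarith
      have := Real.exp_pos δ
      by_contra hc
      push Not at hc
      have := mul_lt_mul_of_pos_right hc this
      linarith
    have h3 : 0 ≤ p * B.card := by positivity
    have := mul_le_mul_of_nonneg_left h2 h3
    nlinarith

theorem pr_high {p : ℝ} (h0 : 0 ≤ p) (h1 : p ≤ 1) (B : Finset V) (δ : ℝ) (hδ : 0 ≤ δ)
    (hδ1 : δ ≤ 1 / 2) :
    prEvent p (fun S => (1 + δ) * (p * B.card) ≤ ((B ∩ S).card : ℝ)) ≤
      Real.exp (-(p * B.card * δ ^ 2 / 3)) := by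
  refine (pr_markov h0 h1 B δ (δ * ((1 + δ) * (p * B.card))) _ ?_).trans ?_
  · intro S hS
    exact mul_le_mul_of_nonneg_left hS hδ
  · apply Real.exp_le_exp.2
    have h2 : Real.exp δ ≤ 1 + δ + 2 / 3 * δ ^ 2 := by
      have h3 := Real.exp_bound' hδ (by linarith) (n := 3) (by norm_num)
      simp [Finset.sum_range_succ, Nat.factorial] at h3
      have := mul_le_mul_of_nonneg_left hδ1 (sq_nonneg δ)
      nlinarith
    have h3 : 0 ≤ p * B.card := by positivity
    have := mul_le_mul_of_nonneg_left h2 h3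
    nlinarith

end Prob

theorem ratio_arith (β ε q X Y : ℝ) (hβ0 : 0 < β) (hε0 : 0 < ε) (hε1 : ε ≤ 1) (hq : 0 < q)
    (g1 : (1 - ε / 2) * (β * q) < X) (g2 : X < (1 + ε / 2) * (β * q))
    (g3 : (1 - ε / 2) * q < Y) (g4 : Y < (1 + ε / 2) * q) :
    β * (1 - ε) ≤ X / Y ∧ X / Y ≤ β * (1 + 2 * ε) := by
  have hY : 0 < Y := lt_of_le_of_lt (mul_nonneg (by linarith) hq.le) g3
  rw [le_div_iff₀ hY, div_le_iff₀ hY]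
  have hq2 : 0 < β * q := by positivity
  constructor
  · have h1 : β * (1 - ε) * Y ≤ β * (1 - ε) * ((1 + ε / 2) * q) :=
      mul_le_mul_of_nonneg_left g4.le (mul_nonneg hβ0.le (by linarith))
    have h2 := mul_nonneg hq2.le (sq_nonneg ε)
    linarith
  · have h1 : β * (1 + 2 * ε) * ((1 - ε / 2) * q) ≤ β * (1 + 2 * ε) * Y :=
      mul_le_mul_of_nonneg_left g3.le (by positivity)
    have h2 := mul_nonneg hq2.le (mul_nonneg hε0.le (sub_nonneg.2 hε1))
    linarith

section Link

variable {V : Type*} [MetricSpace V] [DecidableEq V]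

theorem clDist_set (D E : Finset V) : {r : ℝ | ∃ u ∈ D, ∃ v ∈ E, r = dist u v} =
    ((D ×ˢ E).image fun q => dist q.1 q.2 : Finset ℝ) := by
  ext r
  simp only [Set.mem_setOf_eq, Finset.coe_image, Set.mem_image, Finset.mem_coe,
    Finset.mem_product, Prod.exists]
  constructor
  · rintro ⟨u, hu, v, hv, rfl⟩; exact ⟨u, v, ⟨hu, hv⟩, rfl⟩
  · rintro ⟨u, v, ⟨hu, hv⟩, rfl⟩; exact ⟨u, hu, v, hv, rfl⟩

theorem le_clDist {D E : Finset V} {u v : V} (hu : u ∈ D) (hv : v ∈ E) :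
    dist u v ≤ clDist D E := by
  unfold clDist
  apply le_csSup
  · rw [clDist_set]; exact Finset.bddAbove _
  · exact ⟨u, hu, v, hv, rfl⟩

theorem clDist_attained {D E : Finset V} (hD : D.Nonempty) (hE : E.Nonempty) :
    ∃ u ∈ D, ∃ v ∈ E, clDist D E = dist u v := by
  obtain ⟨u, hu⟩ := hD
  obtain ⟨v, hv⟩ := hE
  have h : clDist D E ∈ {r : ℝ | ∃ u ∈ D, ∃ v ∈ E, r = dist u v} := by
    unfold clDist
    apply Set.Nonempty.csSup_mem
    · exact ⟨_, u, hu, v, hv, rfl⟩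
    · rw [clDist_set]; exact Finset.finite_toSet _
  exact h

structure GoodPart {k : ℕ} (C : Fin k → Finset V) (S : Finset V) (D : Finset (Finset V)) :
    Prop where
  ne : ∀ B ∈ D, B.Nonempty
  sub : ∀ B ∈ D, ∃ i, B ⊆ C i ∩ S
  cov : ∀ v ∈ S, ∃ B ∈ D, v ∈ B
  dis : ∀ B ∈ D, ∀ B' ∈ D, B ≠ B' → Disjoint B B'

theorem merge_card {D D' : Finset (Finset V)} (h : MergeStep D D') : D'.card < D.card := by
  obtain ⟨D₁, h1, D₂, h2, hne, -, rfl⟩ := h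
  have e1 := Finset.card_erase_add_one h1
  have e2 := Finset.card_erase_add_one (Finset.mem_erase.2 ⟨hne.symm, h2⟩)
  have := Finset.card_insert_le (D₁ ∪ D₂) ((D.erase D₁).erase D₂)
  omega

theorem good_step {k : ℕ} (C : Fin k → Finset V)
    (hdisj : ∀ i j, i ≠ j → Disjoint (C i) (C j))
    (hm : ∀ W : Finset V, MarginOnIdx C W) (S : Finset V) {D D' : Finset (Finset V)}
    (hD : GoodPart C S D) (h : MergeStep D D')
    (hc : (Finset.univ.filter fun i => (C i ∩ S).Nonempty).card < D.card) :
    GoodPart C S D' := by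
  classical
  obtain ⟨D₁, h1, D₂, h2, hne, hmin, rfl⟩ := h
  obtain ⟨i₁, hi₁⟩ := hD.sub D₁ h1
  obtain ⟨i₂, hi₂⟩ := hD.sub D₂ h2
  have hsame : i₁ = i₂ := by
    by_contra hi
    have : ∀ B : Finset V, ∃ i, B ∈ D → B ⊆ C i ∩ S := by
      intro B
      by_cases hB : B ∈ D
      · obtain ⟨i, hi⟩ := hD.sub B hB
        exact ⟨i, fun _ => hi⟩
      · exact ⟨i₁, fun h => absurd h hB⟩
    choose f hf using this
    obtain ⟨E₁, he1, E₂, he2, hE, hfe⟩ := Finset.exists_ne_map_eq_of_card_lt_of_maps_to hc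
      (f := f) (by
        intro B hB
        simp only [Finset.coe_filter, Finset.mem_univ, true_and, Set.mem_setOf_eq]
        exact (hD.ne B hB).mono (hf B hB))
    have hle := hmin E₁ he1 E₂ he2 hE
    obtain ⟨u, hu, v, hv, huv⟩ := clDist_attained (hD.ne _ he1) (hD.ne _ he2)
    obtain ⟨x, hx⟩ := hD.ne _ h1
    obtain ⟨y, hy⟩ := hD.ne _ h2
    have hxy := le_clDist hx hy
    have hlt := hm {u, v, x, y} u (by simp) v (by simp) x (by simp) y (by simp)
      (Finset.disjoint_iff_ne.1 (hD.dis _ he1 _ he2 hE) u hu v hv)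
      ⟨f E₁, (Finset.mem_inter.1 (hf _ he1 hu)).1,
        by rw [hfe]; exact (Finset.mem_inter.1 (hf _ he2 hv)).1⟩
      ⟨i₁, i₂, hi, (Finset.mem_inter.1 (hi₁ hx)).1, (Finset.mem_inter.1 (hi₂ hy)).1⟩
    linarith
  subst hsame
  refine ⟨?_, ?_, ?_, ?_⟩
  · intro B hB
    rcases Finset.mem_insert.1 hB with rfl | hB
    · exact (hD.ne _ h1).mono Finset.subset_union_left
    · exact hD.ne _ (Finset.mem_of_mem_erase (Finset.mem_of_mem_erase hB))
  · intro B hB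
    rcases Finset.mem_insert.1 hB with rfl | hB
    · exact ⟨i₁, Finset.union_subset hi₁ hi₂⟩
    · exact hD.sub _ (Finset.mem_of_mem_erase (Finset.mem_of_mem_erase hB))
  · intro v hv
    obtain ⟨B, hB, hvB⟩ := hD.cov v hv
    by_cases hb1 : B = D₁
    · exact ⟨_, Finset.mem_insert_self _ _, Finset.mem_union_left _ (hb1 ▸ hvB)⟩
    by_cases hb2 : B = D₂
    · exact ⟨_, Finset.mem_insert_self _ _, Finset.mem_union_right _ (hb2 ▸ hvB)⟩
    exact ⟨B, Finset.mem_insert_of_mem (Finset.mem_erase.2 ⟨hb2, Finset.mem_erase.2 ⟨hb1, hB⟩⟩), hvB⟩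
  · have key : ∀ B ∈ (D.erase D₁).erase D₂, Disjoint (D₁ ∪ D₂) B := by
      intro B hB
      obtain ⟨hb2, hB⟩ := Finset.mem_erase.1 hB
      obtain ⟨hb1, hB⟩ := Finset.mem_erase.1 hB
      exact Finset.disjoint_union_left.2 ⟨hD.dis _ h1 _ hB (Ne.symm hb1),
        hD.dis _ h2 _ hB (Ne.symm hb2)⟩
    intro B hB B' hB' hBB
    rcases Finset.mem_insert.1 hB with rfl | hB
    · rcases Finset.mem_insert.1 hB' with rfl | hB'
      · exact absurd rfl hBB
      · exact key _ hB'
    · rcases Finset.mem_insert.1 hB' with rfl | hB'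
      · exact (key _ hB).symm
      · exact hD.dis _ (Finset.mem_of_mem_erase (Finset.mem_of_mem_erase hB)) _
          (Finset.mem_of_mem_erase (Finset.mem_of_mem_erase hB')) hBB

theorem good_init {k : ℕ} (C : Fin k → Finset V) (hcover : ∀ v : V, ∃ i, v ∈ C i)
    (S : Finset V) : GoodPart C S (S.image fun v => ({v} : Finset V)) := by
  refine ⟨?_, ?_, ?_, ?_⟩
  · intro B hB
    obtain ⟨v, hv, rfl⟩ := Finset.mem_image.1 hB
    simp
  · intro B hB
    obtain ⟨v, hv, rfl⟩ := Finset.mem_image.1 hB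
    obtain ⟨i, hi⟩ := hcover v
    exact ⟨i, by simp [hi, hv]⟩
  · intro v hv
    exact ⟨{v}, Finset.mem_image_of_mem _ hv, by simp⟩
  · intro B hB B' hB' hBB
    obtain ⟨v, hv, rfl⟩ := Finset.mem_image.1 hB
    obtain ⟨v', hv', rfl⟩ := Finset.mem_image.1 hB'
    simp only [Finset.disjoint_singleton]
    rintro rfl; exact hBB rfl

theorem good_final {k : ℕ} (C : Fin k → Finset V)
    (hdisj : ∀ i j, i ≠ j → Disjoint (C i) (C j)) (S : Finset V) {D : Finset (Finset V)}
    (hD : GoodPart C S D)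
    (hc : D.card = (Finset.univ.filter fun i => (C i ∩ S).Nonempty).card) :
    D = (Finset.univ.image fun i => C i ∩ S).filter Finset.Nonempty := by
  classical
  have huniq : ∀ i j v, v ∈ C i → v ∈ C j → i = j := by
    intro i j v h1 h2
    by_contra h
    exact Finset.disjoint_left.1 (hdisj i j h) h1 h2
  rcases D.eq_empty_or_nonempty with hemp | ⟨B₀, hB₀⟩
  · subst hemp
    ext B
    simp only [Finset.notMem_empty, false_iff, Finset.mem_filter, not_and]
    rintro hB ⟨v, hv⟩
    obtain ⟨i, -, rfl⟩ := Finset.mem_image.1 hB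
    obtain ⟨B, hB, -⟩ := hD.cov v (Finset.mem_inter.1 hv).2
    simp at hB
  haveI : Nonempty (Fin k) := ⟨(hD.sub B₀ hB₀).choose⟩
  choose! f hf using hD.sub
  have himg : D.image f = Finset.univ.filter fun i => (C i ∩ S).Nonempty := by
    ext i
    simp only [Finset.mem_image, Finset.mem_filter, Finset.mem_univ, true_and]
    constructor
    · rintro ⟨B, hB, rfl⟩
      exact (hD.ne B hB).mono (hf B hB)
    · rintro ⟨v, hv⟩
      obtain ⟨hvC, hvS⟩ := Finset.mem_inter.1 hv
      obtain ⟨B, hB, hvB⟩ := hD.cov v hvS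
      exact ⟨B, hB, huniq _ _ v (Finset.mem_inter.1 (hf B hB hvB)).1 hvC⟩
  have hinj : Set.InjOn f D := Finset.card_image_iff.1 (by rw [himg, hc])
  have hblock : ∀ B ∈ D, B = C (f B) ∩ S := by
    intro B hB
    refine Finset.Subset.antisymm (hf B hB) fun v hv => ?_
    obtain ⟨hvC, hvS⟩ := Finset.mem_inter.1 hv
    obtain ⟨B', hB', hvB⟩ := hD.cov v hvS
    have := huniq _ _ v (Finset.mem_inter.1 (hf B' hB' hvB)).1 hvC
    rwa [← hinj hB' hB this]
  ext B
  simp only [Finset.mem_filter, Finset.mem_image, Finset.mem_univ, true_and]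
  constructor
  · intro hB
    exact ⟨⟨f B, (hblock B hB).symm⟩, hD.ne B hB⟩
  · rintro ⟨⟨i, rfl⟩, hne⟩
    have : i ∈ D.image f := by rw [himg]; simpa using hne
    obtain ⟨B, hB, rfl⟩ := Finset.mem_image.1 this
    rw [← hblock B hB]; exact hB

theorem linkage_recovers {k : ℕ} (C : Fin k → Finset V)
    (hdisj : ∀ i j, i ≠ j → Disjoint (C i) (C j)) (hcover : ∀ v : V, ∃ i, v ∈ C i)
    (hm : ∀ W : Finset V, MarginOnIdx C W) (S : Finset V) (D : Finset (Finset V))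
    (h : Relation.ReflTransGen MergeStep (S.image fun v => ({v} : Finset V)) D)
    (hc : D.card = (Finset.univ.filter fun i => (C i ∩ S).Nonempty).card) :
    D = (Finset.univ.image fun i => C i ∩ S).filter Finset.Nonempty := by
  have key : GoodPart C S D ∨
      D.card < (Finset.univ.filter fun i => (C i ∩ S).Nonempty).card := by
    clear hc
    induction h with
    | refl => exact Or.inl (good_init C hcover S)
    | @tail E _ _ hs ih =>
      have hlt := merge_card hs
      rcases ih with ih | ih
      · by_cases hcc : (Finset.univ.filter fun i => (C i ∩ S).Nonempty).card < E.card
        · exact Or.inl (good_step C hdisj hm S ih hs hcc)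
        · right; omega
      · right; omega
  rcases key with key | key
  · exact good_final C hdisj S key hc
  · omega

end Link

/-- composition of Theorem 2: with Bernoulli rate `p = m/n`,
`max(10k, 12k/(βε²))·ln n ≤ m ≤ n`, ground-truth clusters satisfying the margin
property on every subset, `|C₁*| ≥ n/k` and `|A| = β·|C₁*|` for `A ⊆ C₁*`, with
probability at least `1 − k·n^(−5/4) − 4/n`: (i) every cluster of size at least
`n/k` has at least `5·ln n` sampled nodes, (ii) closest-pair agglomeration of
the singletons of `S` down to `k'` blocks recovers the ground-truth clustering
restricted to `S`, and (iii) the threshold estimated from the recovered cluster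
`C₁* ∩ S` lies in `[β(1−ε), β(1+2ε)]`. -/
theorem stmt_12 {V : Type*} [MetricSpace V] [Fintype V] [DecidableEq V]
    (n : ℕ) (hn : Fintype.card V = n) (hn3 : 3 ≤ n)
    (k : ℕ) (hk : 0 < k)
    (Cstar : Fin k → Finset V)
    (hne : ∀ i, (Cstar i).Nonempty)
    (hdisj : ∀ i j, i ≠ j → Disjoint (Cstar i) (Cstar j))
    (hcover : ∀ v : V, ∃ i, v ∈ Cstar i)
    (hC1 : (n : ℝ) / k ≤ ((Cstar ⟨0, hk⟩).card : ℝ))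
    (A : Finset V) (hA : A.Nonempty) (hAC : A ⊆ Cstar ⟨0, hk⟩)
    (β : ℝ) (hβ : (A.card : ℝ) = β * ((Cstar ⟨0, hk⟩).card : ℝ))
    (ε : ℝ) (hε0 : 0 < ε) (hε1 : ε ≤ 1)
    (m : ℕ)
    (hm₁ : max (10 * (k : ℝ)) (12 * k / (β * ε ^ 2)) * Real.log n ≤ (m : ℝ))
    (hm₂ : m ≤ n)
    (hmargin : ∀ W : Finset V, MarginOnIdx Cstar W) :
    1 - k * (n : ℝ) ^ (-(5 / 4 : ℝ)) - 4 / (n : ℝ) ≤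
      prEvent ((m : ℝ) / n) (fun S =>
        (∀ i, (n : ℝ) / k ≤ ((Cstar i).card : ℝ) →
          5 * Real.log n ≤ ((S ∩ Cstar i).card : ℝ)) ∧
        (∀ D : Finset (Finset V),
          Relation.ReflTransGen MergeStep (S.image fun v => ({v} : Finset V)) D →
          D.card = (Finset.univ.filter fun i => (Cstar i ∩ S).Nonempty).card →
          D = (Finset.univ.image fun i => Cstar i ∩ S).filter Finset.Nonempty) ∧
        (β * (1 - ε) ≤ ((A ∩ S).card : ℝ) / (((Cstar ⟨0, hk⟩ ∩ S).card : ℝ)) ∧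
          ((A ∩ S).card : ℝ) / (((Cstar ⟨0, hk⟩ ∩ S).card : ℝ))
            ≤ β * (1 + 2 * ε))) := by
  have hn0 : (0 : ℝ) < n := by exact_mod_cast (by omega : 0 < n)
  have hk0 : (0 : ℝ) < k := by exact_mod_cast hk
  have hp0 : 0 ≤ (m : ℝ) / n := by positivity
  have hp1 : (m : ℝ) / n ≤ 1 := by rw [div_le_one hn0]; exact_mod_cast hm₂
  have hlog : 0 < Real.log n := Real.log_pos (by exact_mod_cast (by omega : 1 < n))
  set c : ℝ := ((Cstar ⟨0, hk⟩).card : ℝ) with hcdef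
  have hc0 : 0 < c := by
    rw [hcdef]; exact_mod_cast (hne _).card_pos
  have ha0 : (0 : ℝ) < A.card := by exact_mod_cast hA.card_pos
  have hac : (A.card : ℝ) ≤ c := by rw [hcdef]; exact_mod_cast Finset.card_le_card hAC
  have hβ0 : 0 < β := by
    by_contra h
    push Not at h
    nlinarith
  have hmk : ∀ x : ℝ, (n : ℝ) / k ≤ x → (m : ℝ) / k ≤ (m : ℝ) / n * x := by
    intro x hx
    have := mul_le_mul_of_nonneg_left hx hp0
    have e : (m : ℝ) / n * (n / k) = m / k := by field_simp
    linarith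
  have hm10 : 10 * Real.log n ≤ (m : ℝ) / k := by
    rw [le_div_iff₀ hk0]
    have := mul_le_mul_of_nonneg_right (le_max_left (10 * (k : ℝ)) (12 * k / (β * ε ^ 2))) hlog.le
    linarith
  have hm12 : 12 * Real.log n ≤ β * ε ^ 2 * ((m : ℝ) / k) := by
    have h1 := mul_le_mul_of_nonneg_right
      (le_max_right (10 * (k : ℝ)) (12 * k / (β * ε ^ 2))) hlog.le
    have h2 := h1.trans hm₁
    have hbe : 0 < β * ε ^ 2 := by positivity
    rw [div_mul_eq_mul_div, div_le_iff₀ hbe] at h2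
    rw [← mul_div_assoc, le_div_iff₀ hk0]
    linarith
  set p : ℝ := (m : ℝ) / n with hp
  have hA12 : 12 * Real.log n ≤ p * A.card * ε ^ 2 := by
    have h1 := mul_le_mul_of_nonneg_left (hmk c hC1) (by positivity : 0 ≤ β * ε ^ 2)
    rw [hβ]; linarith
  have hC12 : 12 * Real.log n ≤ p * c * ε ^ 2 := by
    refine hA12.trans ?_
    gcongr
  have hexp : ∀ x, Real.log n ≤ x → Real.exp (-x) ≤ 1 / n := by
    intro x hx
    rw [Real.exp_neg, ← one_div]
    apply one_div_le_one_div_of_le hn0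
    rw [← Real.log_le_iff_le_exp hn0]
    exact hx
  have b1 := (pr_low hp0 hp1 A (ε / 2) (by linarith)).trans (hexp _ (by nlinarith))
  have b2 := (pr_high hp0 hp1 A (ε / 2) (by linarith) (by linarith)).trans (hexp _ (by nlinarith))
  have b3 := (pr_low hp0 hp1 (Cstar ⟨0, hk⟩) (ε / 2) (by linarith)).trans (hexp _ (by nlinarith))
  have b4 := (pr_high hp0 hp1 (Cstar ⟨0, hk⟩) (ε / 2) (by linarith) (by linarith)).trans
    (hexp _ (by nlinarith))
  have b5 : ∀ i, prEvent p (fun S => (n : ℝ) / k ≤ ((Cstar i).card : ℝ) ∧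
      ((Cstar i ∩ S).card : ℝ) ≤ (1 - 1 / 2) * (p * (Cstar i).card)) ≤
      (n : ℝ) ^ (-(5 / 4 : ℝ)) := by
    intro i
    by_cases hi : (n : ℝ) / k ≤ ((Cstar i).card : ℝ)
    · refine (pr_mono hp0 hp1 fun S h => h.2).trans
        ((pr_low hp0 hp1 (Cstar i) (1 / 2) (by norm_num)).trans ?_)
      rw [Real.rpow_def_of_pos hn0]
      apply Real.exp_le_exp.2
      have := hmk _ hi
      linarith
    · have : prEvent p (fun S => (n : ℝ) / k ≤ ((Cstar i).card : ℝ) ∧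
        ((Cstar i ∩ S).card : ℝ) ≤ (1 - 1 / 2) * (p * (Cstar i).card)) = 0 := by
        simp [prEvent, hi]
      rw [this]; positivity
  have b6 := (pr_ex hp0 hp1 (fun i S => (n : ℝ) / k ≤ ((Cstar i).card : ℝ) ∧
      ((Cstar i ∩ S).card : ℝ) ≤ (1 - 1 / 2) * (p * (Cstar i).card))).trans
      (Finset.sum_le_sum fun i _ => b5 i)
  rw [Finset.sum_const, Finset.card_univ, Fintype.card_fin, nsmul_eq_mul] at b6
  have o1 := pr_or hp0 hp1 (fun S => ((A ∩ S).card : ℝ) ≤ (1 - ε / 2) * (p * A.card))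
    (fun S => (1 + ε / 2) * (p * A.card) ≤ ((A ∩ S).card : ℝ))
  have o2 := pr_or hp0 hp1
    (fun S => ((Cstar ⟨0, hk⟩ ∩ S).card : ℝ) ≤ (1 - ε / 2) * (p * (Cstar ⟨0, hk⟩).card))
    (fun S => (1 + ε / 2) * (p * (Cstar ⟨0, hk⟩).card) ≤ ((Cstar ⟨0, hk⟩ ∩ S).card : ℝ))
  have o3 := pr_or hp0 hp1 _ _ |>.trans (add_le_add o1 o2)
  have o4 := pr_or hp0 hp1 _ _ |>.trans (add_le_add b6 o3)
  rw [← pr_not]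
  have h4 : 4 / (n : ℝ) = 4 * (1 / n) := by ring
  refine le_trans ?_ (sub_le_sub_left (pr_mono hp0 hp1 ?_ |>.trans o4) 1)
  · rw [h4]; linarith
  intro S hS
  by_contra hbad
  apply hS
  simp only [not_or, not_exists, not_and, not_le] at hbad
  obtain ⟨g0, ⟨g1, g2⟩, g3, g4⟩ := hbad
  refine ⟨?_, fun D => linkage_recovers Cstar hdisj hcover hmargin S D, ?_⟩
  · intro i hi
    have h1 := g0 i hi
    have h2 := hmk _ hi
    rw [Finset.inter_comm]
    linarith
  · have hp' : 0 < p := by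
      rcases hp0.eq_or_lt with h | h
      · rw [← h] at hA12
        linarith
      · exact h
    have e : p * (A.card : ℝ) = β * (p * c) := by rw [hβ]; ring
    rw [e] at g1 g2
    exact ratio_arith β ε (p * c) _ _ hβ0 hε0 hε1 (mul_pos hp' hc0) g1 g2 g3 g4
end
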